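/- arXiv:1610.08143 — 10 statements merged into one kernel-verified Lean document; each statement's English description precedes it below -/
import Mathlib

section
/- Let σ > 0, r > 0, c > 0 and μ ∈ ℝ with r ≥ μ, and define g(s) = μcs − (σ²c²s²)/2 − r e^{cs} + r. Then g(s) ≤ 0 for every s ≥ 0. -/
/-- For σ > 0, r > 0, c > 0, μ ≤ r, the function
g(s) = μcs − (σ²c²s²)/2 − r e^{cs} + r is nonpositive on [0, ∞). -/
theorem gbm_exp_trivial_case (σ r c μ : ℝ) (hσ : 0 < σ) (hr : 0 < r) (hc : 0 < c)
    (hrμ : μ ≤ r) :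
    ∀ s : ℝ, 0 ≤ s →
      μ * c * s - σ^2 * c^2 * s^2 / 2 - r * Real.exp (c * s) + r ≤ 0 := by
  intro s hs
  have h_exp : r * (c * s + 1) ≤ r * Real.exp (c * s) :=
    mul_le_mul_of_nonneg_left (Real.add_one_le_exp (c * s)) hr.le
  have h_drift : μ * (c * s) ≤ r * (c * s) :=
    mul_le_mul_of_nonneg_right hrμ (mul_nonneg hc.le hs)
  have h_sq : 0 ≤ σ^2 * c^2 * s^2 := by positivity
  linarith
end

section
/- Let σ > 0, r > 0, c > 0 and μ ∈ ℝ with μ > r, and define g(s) = μcs − (σ²c²s²)/2 − r e^{cs} + r. Then g is strictly concave on [0, ∞), g(0) = 0, and there exists a unique φ > 0 such that g(φ) = 0; moreover g(s) > 0 for 0 < s < φ and g(s) < 0 for s > φ. -/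
/-- A strictly concave function on `[0, ∞)` vanishing at `0` is positive to the left of any
point where it is nonnegative. -/
lemma StrictConcaveOn.pos_of_lt_of_nonneg {f : ℝ → ℝ} (hf : StrictConcaveOn ℝ (Set.Ici (0:ℝ)) f)
    (h0 : f 0 = 0) {s t : ℝ} (hs : 0 < s) (hst : s < t) (ht : 0 ≤ f t) : 0 < f s := by
  have htpos : 0 < t := hs.trans hst
  have hseg : s ∈ openSegment ℝ 0 t := by
    rw [openSegment_eq_Ioo htpos]
    exact ⟨hs, hst⟩
  have hmin := hf.lt_on_openSegment (Set.mem_Ici.2 le_rfl) (Set.mem_Ici.2 htpos.le) htpos.ne hseg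
  rwa [h0, min_eq_left ht] at hmin

/-- A continuous strictly concave function on `[0, ∞)` that vanishes at `0` and takes both a
positive and a negative value on `(0, ∞)` has exactly one positive root, where it changes sign. -/
lemma StrictConcaveOn.exists_unique_pos_root {f : ℝ → ℝ}
    (hf : StrictConcaveOn ℝ (Set.Ici (0:ℝ)) f) (hcont : Continuous f) (h0 : f 0 = 0)
    {a b : ℝ} (ha : 0 < a) (hfa : 0 < f a) (hb : 0 < b) (hfb : f b < 0) :
    ∃ φ : ℝ, 0 < φ ∧ f φ = 0 ∧
      (∀ ψ : ℝ, 0 < ψ → f ψ = 0 → ψ = φ) ∧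
      (∀ s : ℝ, 0 < s → s < φ → 0 < f s) ∧
      (∀ s : ℝ, φ < s → f s < 0) := by
  have hab : a ≤ b := by
    by_contra! hba
    exact hfb.not_gt (hf.pos_of_lt_of_nonneg h0 hb hba hfa.le)
  obtain ⟨φ, hφ, hfφ⟩ := intermediate_value_Icc' hab hcont.continuousOn ⟨hfb.le, hfa.le⟩
  have hφpos : 0 < φ := ha.trans_le hφ.1
  have hleft : ∀ s : ℝ, 0 < s → s < φ → 0 < f s := fun s hs hsφ =>
    hf.pos_of_lt_of_nonneg h0 hs hsφ hfφ.ge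
  have hright : ∀ s : ℝ, φ < s → f s < 0 := by
    intro s hs
    by_contra! hfs
    exact (hf.pos_of_lt_of_nonneg h0 hφpos hs hfs).ne' hfφ
  refine ⟨φ, hφpos, hfφ, fun ψ hψ hfψ => ?_, hleft, hright⟩
  rcases lt_trichotomy ψ φ with h | h | h
  · exact absurd hfψ (hleft ψ hψ h).ne'
  · exact h
  · exact absurd hfψ (hright ψ h).ne

/-- For σ > 0, r > 0, c > 0 and μ > r, the function
g(s) = μcs − (σ²c²s²)/2 − r e^{cs} + r is strictly concave on [0,∞), g(0) = 0,
and there is a unique φ > 0 with g(φ) = 0; g > 0 on (0, φ) and g < 0 on (φ, ∞). -/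
theorem gbm_exp_g_unique_root (σ r c μ : ℝ) (hσ : 0 < σ) (hr : 0 < r) (hc : 0 < c)
    (hμr : r < μ)
    (g : ℝ → ℝ)
    (hg : g = fun s => μ * c * s - σ^2 * c^2 * s^2 / 2 - r * Real.exp (c * s) + r) :
    StrictConcaveOn ℝ (Set.Ici (0:ℝ)) g ∧ g 0 = 0 ∧
    ∃ φ : ℝ, 0 < φ ∧ g φ = 0 ∧
      (∀ ψ : ℝ, 0 < ψ → g ψ = 0 → ψ = φ) ∧
      (∀ s : ℝ, 0 < s → s < φ → 0 < g s) ∧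
      (∀ s : ℝ, φ < s → g s < 0) := by
  have hconc : StrictConcaveOn ℝ (Set.Ici (0:ℝ)) g := by
    refine ⟨convex_Ici 0, fun x _ y _ hxy a b ha hb hab => ?_⟩
    have hexp := strictConvexOn_exp.2 (Set.mem_univ (c * x)) (Set.mem_univ (c * y))
      (fun h => hxy (mul_left_cancel₀ hc.ne' h)) ha hb hab
    have hsq : 0 ≤ σ ^ 2 * c ^ 2 * (a * b * (x - y) ^ 2) := by positivity
    simp only [hg, smul_eq_mul] at hexp ⊢
    rw [show a * (c * x) + b * (c * y) = c * (a * x + b * y) by ring] at hexp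
    have hrexp := mul_lt_mul_of_pos_left hexp hr
    obtain rfl : b = 1 - a := by linarith
    linear_combination hrexp + hsq / 2
  have hg0 : g 0 = 0 := by simp [hg]
  have hμ : 0 < μ := hr.trans hμr
  have hcont : Continuous g := by
    rw [hg]
    fun_prop
  refine ⟨hconc, hg0, ?_⟩
  have hd : 0 < μ + σ ^ 2 := by positivity
  set x := (μ - r) / (μ + σ ^ 2) with hx
  have hxpos : 0 < x := div_pos (sub_pos.2 hμr) hd
  have hxmul : x * (μ + σ ^ 2) = μ - r := div_mul_cancel₀ _ hd.ne'
  have hxle : x ≤ 1 := (div_le_one hd).2 (by nlinarith [sq_nonneg σ])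
  have hga : 0 < g (x / c) := by
    have hcx : c * (x / c) = x := mul_div_cancel₀ x hc.ne'
    have hexp := (abs_le.1 (Real.abs_exp_sub_one_sub_id_le
      (x := x) (by rwa [abs_of_pos hxpos]))).2
    have hval : g (x / c) = μ * x - σ ^ 2 * x ^ 2 / 2 - r * Real.exp x + r := by
      simp only [hg, hcx]
      field_simp
    have hquad : 0 < x ^ 2 * (μ - r + σ ^ 2 / 2) :=
      mul_pos (pow_pos hxpos 2) (by nlinarith [sq_nonneg σ])
    rw [hval]
    linear_combination hquad + r * hexp + x * hxmul
  have hb : 0 < 2 * μ / (σ ^ 2 * c) := by positivity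
  have hgb : g (2 * μ / (σ ^ 2 * c)) < 0 := by
    have hexp : 1 < Real.exp (c * (2 * μ / (σ ^ 2 * c))) := Real.one_lt_exp_iff.2 (by positivity)
    have hzero : μ * c * (2 * μ / (σ ^ 2 * c)) -
        σ ^ 2 * c ^ 2 * (2 * μ / (σ ^ 2 * c)) ^ 2 / 2 = 0 := by
      field_simp
      ring
    simp only [hg]
    rw [hzero]
    linarith [mul_lt_mul_of_pos_left hexp hr]
  exact hconc.exists_unique_pos_root hcont hg0 (div_pos hxpos hc) hga hb hgb
end

section
/- Let α ∈ (0,1) and c > 0, and let a > 0 be the unique positive root of α(e^{ca} − 1) = ca. Then the function s ↦ (1 − e^{−cs})/s^α is strictly increasing on (0, a] and strictly decreasing on [a, ∞); in particular a is its unique maximizer on (0, ∞), and (1 − e^{−cs})/s^α ≤ (1 − e^{−ca})/a^α for all s > 0. -/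
open Real Set in
theorem Real.exp_sub_one_mul_lt_mul {x y : ℝ} (hx : 0 < x) (hxy : x < y) :
    (exp x - 1) * y < (exp y - 1) * x := by
  have h := strictConvexOn_exp.secant_strict_mono (mem_univ 0) (mem_univ x) (mem_univ y)
    hx.ne' (hx.trans hxy).ne' hxy
  simpa [div_lt_div_iff₀ hx (hx.trans hxy)] using h

theorem hasDerivAt_one_sub_exp_neg_div_rpow (α c : ℝ) {s : ℝ} (hs : 0 < s) :
    HasDerivAt (fun s : ℝ => (1 - Real.exp (-(c * s))) / s ^ α)
      (Real.exp (-(c * s)) / (s ^ α * s) * (c * s - α * (Real.exp (c * s) - 1))) s := by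
  have hpow : HasDerivAt (fun s : ℝ => s ^ α) (α * s ^ (α - 1)) s :=
    Real.hasDerivAt_rpow_const (Or.inl hs.ne')
  have hexp : HasDerivAt (fun s : ℝ => 1 - Real.exp (-(c * s)))
      (-(Real.exp (-(c * s)) * (-(c * 1)))) s :=
    (((hasDerivAt_id s).const_mul c).neg.exp).const_sub 1
  have hspos : 0 < s ^ α := Real.rpow_pos_of_pos hs α
  refine (hexp.div hpow hspos.ne').congr_deriv ?_
  rw [Real.rpow_sub_one hs.ne', Real.exp_neg]
  have := Real.exp_pos (c * s)
  field_simp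

/-- For α ∈ (0,1), c > 0 and a > 0 the positive root of α(e^{ca} − 1) = ca,
the function s ↦ (1 − e^{−cs})/s^α is strictly increasing on (0, a], strictly
decreasing on [a, ∞), a is its unique maximizer on (0,∞), and it is maximized at a. -/
theorem gbm_exp_value_dominates (α c a : ℝ) (hα0 : 0 < α) (hα1 : α < 1)
    (hc : 0 < c) (ha : 0 < a)
    (haroot : α * (Real.exp (c * a) - 1) - c * a = 0)
    (f : ℝ → ℝ)
    (hf : f = fun s => (1 - Real.exp (-(c * s))) / s ^ α) :
    StrictMonoOn f (Set.Ioc 0 a) ∧ StrictAntiOn f (Set.Ici a) ∧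
    (∀ s : ℝ, 0 < s → s ≠ a → f s < f a) ∧
    (∀ s : ℝ, 0 < s → f s ≤ f a) := by
  have hderiv (s : ℝ) (hs : 0 < s) : HasDerivAt f
      (Real.exp (-(c * s)) / (s ^ α * s) * (c * s - α * (Real.exp (c * s) - 1))) s :=
    hf ▸ hasDerivAt_one_sub_exp_neg_div_rpow α c hs
  have hfactor (s : ℝ) (hs : 0 < s) : 0 < Real.exp (-(c * s)) / (s ^ α * s) := by positivity
  have hca : 0 < c * a := mul_pos hc ha
  have hmono : StrictMonoOn f (Set.Ioc 0 a) := by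
    refine strictMonoOn_of_deriv_pos (convex_Ioc 0 a)
      (fun s hs => (hderiv s hs.1).continuousAt.continuousWithinAt) fun s hs => ?_
    rw [interior_Ioc] at hs
    rw [(hderiv s hs.1).deriv]
    refine mul_pos (hfactor s hs.1) (pos_of_mul_pos_left (b := c * a) ?_ hca.le)
    have h := mul_lt_mul_of_pos_left (Real.exp_sub_one_mul_lt_mul (mul_pos hc hs.1)
      (mul_lt_mul_of_pos_left hs.2 hc)) hα0
    linear_combination h + c * s * haroot
  have hanti : StrictAntiOn f (Set.Ici a) := by
    refine strictAntiOn_of_deriv_neg (convex_Ici a)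
      (fun s hs => (hderiv s (ha.trans_le hs)).continuousAt.continuousWithinAt) fun s hs => ?_
    rw [interior_Ici] at hs
    have hs0 : 0 < s := ha.trans hs
    rw [(hderiv s hs0).deriv]
    refine mul_neg_of_pos_of_neg (hfactor s hs0) (neg_of_mul_neg_left (b := c * a) ?_ hca.le)
    have h := mul_lt_mul_of_pos_left (Real.exp_sub_one_mul_lt_mul hca
      (mul_lt_mul_of_pos_left hs hc)) hα0
    linear_combination h - c * s * haroot
  have hmax (s : ℝ) (hs : 0 < s) (hsa : s ≠ a) : f s < f a := by
    rcases hsa.lt_or_gt with h | h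
    · exact hmono ⟨hs, h.le⟩ ⟨ha, le_rfl⟩ h
    · exact hanti Set.self_mem_Ici h.le h
  refine ⟨hmono, hanti, hmax, fun s hs => ?_⟩
  rcases eq_or_ne s a with rfl | hsa
  · exact le_rfl
  · exact (hmax s hs hsa).le
end

section
/- Let σ > 0, r > 0, c > 0 and μ ∈ ℝ with μ > r, set α = (1/2 − μ/σ²) + √((μ/σ² − 1/2)² + 2r/σ²) (so 0 < α < 1), let a > 0 be the unique positive root of α(e^{ca} − 1) = ca, and let φ > 0 be the unique positive root of g(s) = μcs − (σ²c²s²)/2 − r e^{cs} + r. Then a > φ; consequently g(s) < 0 for every s ≥ a. -/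
/-- The fundamental quadratic of geometric Brownian motion, for its larger root. -/
lemma gbm_quadratic_root {σ r μ α : ℝ} (hσ : 0 < σ) (hr : 0 < r)
    (hα : α = (1/2 - μ/σ^2) + Real.sqrt ((μ/σ^2 - 1/2)^2 + 2*r/σ^2)) :
    σ^2 / 2 * α * (α - 1) + μ * α - r = 0 := by
  have hsq : Real.sqrt ((μ/σ^2 - 1/2)^2 + 2*r/σ^2) ^ 2 = (μ/σ^2 - 1/2)^2 + 2*r/σ^2 :=
    Real.sq_sqrt (by positivity)
  rw [show Real.sqrt ((μ/σ^2 - 1/2)^2 + 2*r/σ^2) = α - (1/2 - μ/σ^2) by linarith] at hsq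
  field_simp at hsq
  have hσ2 : σ ^ 2 ≠ 0 := by positivity
  apply mul_left_cancel₀ hσ2
  linarith

/-- The secant slope of `exp` from the origin is monotone. -/
lemma mul_exp_sub_one_le {x y : ℝ} (hx : 0 < x) (hxy : x ≤ y) :
    y * (Real.exp x - 1) ≤ x * (Real.exp y - 1) := by
  have hy : 0 < y := hx.trans_le hxy
  have h := convexOn_exp.2 (Set.mem_univ y) (Set.mem_univ 0) (div_nonneg hx.le hy.le)
    (sub_nonneg.2 ((div_le_one hy).2 hxy)) (add_sub_cancel (x / y) 1)
  simp only [smul_eq_mul, mul_zero, add_zero, Real.exp_zero, mul_one,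
    div_mul_cancel₀ x hy.ne'] at h
  calc y * (Real.exp x - 1) ≤ y * (x / y * Real.exp y + (1 - x / y) - 1) := by gcongr
    _ = x * (Real.exp y - 1) := by field_simp; ring

/-- A positive solution of `α (exp x - 1) = x` satisfies `1 - α < x`. -/
lemma one_sub_lt_of_mul_exp_sub_one_eq {α x : ℝ} (hx : 0 < x)
    (h : α * (Real.exp x - 1) = x) : 1 - α < x := by
  have hE : 0 < Real.exp x - 1 := sub_pos.2 (Real.one_lt_exp_iff.2 hx)
  have h1 : (1 - x) * Real.exp x < 1 := by
    calc (1 - x) * Real.exp x < Real.exp (-x) * Real.exp x := by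
          gcongr
          linarith [Real.add_one_lt_exp (neg_ne_zero.2 hx.ne')]
      _ = 1 := by rw [← Real.exp_add, neg_add_cancel, Real.exp_zero]
  have h2 : 0 < (x + α - 1) * (Real.exp x - 1) := by linarith
  linarith [pos_of_mul_pos_left h2 hE.le]

/-- For σ > 0, r > 0, c > 0, μ > r, α as in the GBM quadratic, a the positive
root of α(e^{ca} − 1) = ca, and φ the positive root of
g(s) = μcs − (σ²c²s²)/2 − re^{cs} + r, one has a > φ, hence g < 0 on [a, ∞). -/
theorem gbm_exp_threshold_above_root (σ r c μ α a φ : ℝ)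
    (hσ : 0 < σ) (hr : 0 < r) (hc : 0 < c) (hμr : r < μ)
    (hα : α = (1/2 - μ/σ^2) + Real.sqrt ((μ/σ^2 - 1/2)^2 + 2*r/σ^2))
    (ha : 0 < a) (haroot : α * (Real.exp (c * a) - 1) - c * a = 0)
    (hφ : 0 < φ)
    (hφroot : μ * c * φ - σ^2 * c^2 * φ^2 / 2 - r * Real.exp (c * φ) + r = 0) :
    φ < a ∧
    ∀ s : ℝ, a ≤ s →
      μ * c * s - σ^2 * c^2 * s^2 / 2 - r * Real.exp (c * s) + r < 0 := by
  have hx : 0 < c * a := mul_pos hc ha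
  have hroot : α * (Real.exp (c * a) - 1) = c * a := sub_eq_zero.1 haroot
  have hα0 : 0 < α := pos_of_mul_pos_left (by rwa [hroot])
    (sub_pos.2 (Real.one_lt_exp_iff.2 hx)).le
  have hquad := gbm_quadratic_root hσ hr hα
  have hlt := one_sub_lt_of_mul_exp_sub_one_eq hx hroot
  have hga : μ * c * a - σ^2 * c^2 * a^2 / 2 - r * Real.exp (c * a) + r < 0 := by
    have key : α * (μ * c * a - σ^2 * c^2 * a^2 / 2 - r * Real.exp (c * a) + r)
        = -(α * (c * a) * (σ^2 / 2) * (c * a - (1 - α))) := by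
      linear_combination (c * a) * hquad - r * hroot
    have hpos : 0 < α * (c * a) * (σ^2 / 2) * (c * a - (1 - α)) :=
      mul_pos (by positivity) (sub_pos.2 hlt)
    exact neg_of_mul_neg_right (by linarith) hα0.le
  have hneg : ∀ s : ℝ, a ≤ s →
      μ * c * s - σ^2 * c^2 * s^2 / 2 - r * Real.exp (c * s) + r < 0 := by
    intro s hs
    have hs0 : 0 < s := ha.trans_le hs
    have hexp := mul_le_mul_of_nonneg_left
      (mul_exp_sub_one_le hx (mul_le_mul_of_nonneg_left hs hc.le)) hr.le
    have hsq : 0 ≤ c * (σ^2 * c^2 / 2 * (a * s) * (s - a)) :=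
      mul_nonneg hc.le (mul_nonneg (by positivity) (sub_nonneg.2 hs))
    have hgs := mul_neg_of_pos_of_neg (mul_pos hc hs0) hga
    exact neg_of_mul_neg_right (a := c * a) (by linarith) hx.le
  refine ⟨?_, hneg⟩
  by_contra! h
  exact (hneg φ h).ne hφroot
end

section
/- Let σ > 0, r > 0 and μ ∈ ℝ, and define α = (1/2 − μ/σ²) + √((μ/σ² − 1/2)² + 2r/σ²). Then 1/α > (μ − σ²/2)/r; equivalently, the optimal log-utility selling threshold e^{1/α} strictly exceeds e^{(μ − σ²/2)/r}, the unique root of s ↦ μ − σ²/2 − r log(s). -/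
/-- The larger root of the characteristic quadratic of geometric Brownian motion is positive. -/
theorem gbm_root_pos (σ r μ : ℝ) (hσ : 0 < σ) (hr : 0 < r) :
    0 < (1/2 - μ/σ^2) + Real.sqrt ((μ/σ^2 - 1/2)^2 + 2*r/σ^2) := by
  have h : μ/σ^2 - 1/2 < Real.sqrt ((μ/σ^2 - 1/2)^2 + 2*r/σ^2) :=
    Real.lt_sqrt_of_sq_lt (lt_add_of_pos_right _ (by positivity))
  linarith

/-- The larger root satisfies the characteristic quadratic of geometric Brownian motion. -/
theorem gbm_root_quadratic (σ r μ α : ℝ) (hσ : 0 < σ) (hr : 0 < r)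
    (hα : α = (1/2 - μ/σ^2) + Real.sqrt ((μ/σ^2 - 1/2)^2 + 2*r/σ^2)) :
    σ^2/2 * α * (α - 1) + μ * α - r = 0 := by
  have hsq : (α + (μ/σ^2 - 1/2))^2 = (μ/σ^2 - 1/2)^2 + 2*r/σ^2 := by
    rw [← Real.sq_sqrt (show 0 ≤ (μ/σ^2 - 1/2)^2 + 2*r/σ^2 by positivity), hα]
    ring
  field_simp at hsq
  have hσ2 : σ^2 ≠ 0 := by positivity
  refine (mul_eq_zero.mp ?_).resolve_left hσ2
  linarith

/-- For σ > 0, r > 0, μ ∈ ℝ and α = (1/2 − μ/σ²) + √((μ/σ² − 1/2)² + 2r/σ²),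
one has 1/α > (μ − σ²/2)/r; equivalently e^{1/α} > e^{(μ − σ²/2)/r}. -/
theorem gbm_log_threshold_inequality (σ r μ : ℝ) (hσ : 0 < σ) (hr : 0 < r)
    (α : ℝ)
    (hα : α = (1/2 - μ/σ^2) + Real.sqrt ((μ/σ^2 - 1/2)^2 + 2*r/σ^2)) :
    (μ - σ^2/2) / r < 1 / α ∧
    Real.exp ((μ - σ^2/2) / r) < Real.exp (1 / α) := by
  have hpos : 0 < α := hα ▸ gbm_root_pos σ r μ hσ hr
  have hlt : (μ - σ^2/2) / r < 1 / α := by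
    rw [div_lt_div_iff₀ hr hpos]
    have hquad := gbm_root_quadratic σ r μ α hσ hr hα
    have : 0 < σ^2/2 * α^2 := by positivity
    linarith
  exact ⟨hlt, Real.exp_lt_exp.mpr hlt⟩
end

section
/- Let κ > 0, η > 0, r > 0 and θ ∈ ℝ, and define F(z) = ∫₀^∞ υ^{r/κ − 1} exp(√(2κ/η²)(z − θ)υ − υ²/2) dυ. Then F is twice differentiable on ℝ and satisfies (η²/2)F''(z) + κ(θ − z)F'(z) − r F(z) = 0 for every z ∈ ℝ. -/
/-- The increasing solution F of the OU ODE. -/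
noncomputable def ouF (κ θ η r : ℝ) (z : ℝ) : ℝ :=
  ∫ υ in Set.Ioi (0:ℝ),
    υ ^ (r/κ - 1) * Real.exp (Real.sqrt (2*κ/η^2) * (z - θ) * υ - υ^2/2)

/-- The kernel `υ ^ s * exp (x υ - υ² / 2)` is integrable on the positive half-line. -/
lemma integrableOn_rpow_mul_exp_sub_sq {s : ℝ} (hs : -1 < s) (x : ℝ) :
    MeasureTheory.IntegrableOn (fun υ : ℝ => υ ^ s * Real.exp (x * υ - υ^2/2)) (Set.Ioi 0) := by
  refine MeasureTheory.Integrable.mono'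
    ((integrableOn_rpow_mul_exp_neg_mul_sq (b := 1/4) (by norm_num) hs).const_mul
      (Real.exp (x^2))) (by fun_prop) ?_
  filter_upwards [MeasureTheory.ae_restrict_mem measurableSet_Ioi] with υ hυ
  have h0 : 0 ≤ υ ^ s := Real.rpow_nonneg (le_of_lt hυ) s
  rw [Real.norm_of_nonneg (by positivity), mul_left_comm, ← Real.exp_add]
  gcongr
  nlinarith [sq_nonneg (x - υ/2)]

/-- Differentiating under the integral sign raises the exponent by one. -/
lemma hasDerivAt_integral_rpow_mul_exp_sub_sq {s : ℝ} (hs : -1 < s) (x : ℝ) :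
    HasDerivAt (fun y : ℝ => ∫ υ in Set.Ioi (0:ℝ), υ ^ s * Real.exp (y * υ - υ^2/2))
      (∫ υ in Set.Ioi (0:ℝ), υ ^ (s + 1) * Real.exp (x * υ - υ^2/2)) x := by
  refine (hasDerivAt_integral_of_dominated_loc_of_deriv_le
    (F := fun y υ => υ ^ s * Real.exp (y * υ - υ^2/2))
    (μ := MeasureTheory.volume.restrict (Set.Ioi 0))
    (F' := fun y υ => υ ^ (s + 1) * Real.exp (y * υ - υ^2/2))
    (bound := fun υ => υ ^ (s + 1) * Real.exp ((x + 1) * υ - υ^2/2))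
    (Iio_mem_nhds (lt_add_one x)) (.of_forall fun y => by fun_prop)
    (integrableOn_rpow_mul_exp_sub_sq hs x) (by fun_prop) ?_
    (integrableOn_rpow_mul_exp_sub_sq (by linarith) (x + 1)) ?_).2
  · filter_upwards [MeasureTheory.ae_restrict_mem measurableSet_Ioi] with υ hυ y hy
    have hυ' : 0 ≤ υ := le_of_lt hυ
    have h0 : 0 ≤ υ ^ (s + 1) := Real.rpow_nonneg hυ' _
    rw [Real.norm_of_nonneg (by positivity)]
    gcongr
    exact le_of_lt hy
  · filter_upwards [MeasureTheory.ae_restrict_mem measurableSet_Ioi] with υ hυ y _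
    have h := ((((hasDerivAt_id y).mul_const υ).sub_const (υ^2/2)).exp).const_mul (υ ^ s)
    refine h.congr_deriv ?_
    rw [Real.rpow_add_one (ne_of_gt hυ)]
    simp only [id]
    ring

/-- Integration by parts for the kernel `υ ^ s * exp (x υ - υ² / 2)`. -/
lemma integral_rpow_add_two_mul_exp_sub_sq {s : ℝ} (hs : -1 < s) (x : ℝ) :
    ∫ υ in Set.Ioi (0:ℝ), υ ^ (s + 1 + 1) * Real.exp (x * υ - υ^2/2) =
      x * (∫ υ in Set.Ioi (0:ℝ), υ ^ (s + 1) * Real.exp (x * υ - υ^2/2)) +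
      (s + 1) * ∫ υ in Set.Ioi (0:ℝ), υ ^ s * Real.exp (x * υ - υ^2/2) := by
  have i0 := (integrableOn_rpow_mul_exp_sub_sq hs x).const_mul (s + 1)
  have i1 := integrableOn_rpow_mul_exp_sub_sq (s := s + 1) (by linarith) x
  have i2 := integrableOn_rpow_mul_exp_sub_sq (s := s + 1 + 1) (by linarith) x
  have i1' := i1.const_mul x
  have hderiv : ∀ υ ∈ Set.Ioi (0:ℝ),
      HasDerivAt (fun υ : ℝ => υ ^ (s + 1) * Real.exp (x * υ - υ^2/2))
        (x * (υ ^ (s + 1) * Real.exp (x * υ - υ^2/2)) +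
          (s + 1) * (υ ^ s * Real.exp (x * υ - υ^2/2)) -
          υ ^ (s + 1 + 1) * Real.exp (x * υ - υ^2/2)) υ := by
    intro υ hυ
    have hne : υ ≠ 0 := ne_of_gt hυ
    have h := (Real.hasDerivAt_rpow_const (p := s + 1) (Or.inl hne)).mul
      ((((hasDerivAt_id υ).const_mul x).sub (((hasDerivAt_id υ).pow 2).div_const 2)).exp)
    refine h.congr_deriv ?_
    rw [Real.rpow_add_one hne (s + 1), add_sub_cancel_right]
    simp
    ring
  have hcont : ContinuousWithinAt (fun υ : ℝ => υ ^ (s + 1) * Real.exp (x * υ - υ^2/2))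
      (Set.Ici 0) 0 :=
    ((Real.continuousAt_rpow_const 0 (s + 1) (Or.inr (by linarith))).mul
      (by fun_prop)).continuousWithinAt
  have hint := (i1'.add i0).sub i2
  have key := MeasureTheory.integral_Ioi_of_hasDerivAt_of_tendsto hcont hderiv hint
    (MeasureTheory.tendsto_zero_of_hasDerivAt_of_integrableOn_Ioi hderiv hint i1)
  rw [MeasureTheory.integral_sub (by exact i1'.add i0) i2, MeasureTheory.integral_add i1' i0,
    MeasureTheory.integral_const_mul, MeasureTheory.integral_const_mul,
    Real.zero_rpow (by linarith)] at key
  linarith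

/-- For κ, η, r > 0 and θ ∈ ℝ, F is twice differentiable on ℝ and satisfies
(η²/2)F'' + κ(θ − z)F' − rF = 0 everywhere. -/
theorem ouF_solves_ode (κ θ η r : ℝ) (hκ : 0 < κ) (hη : 0 < η) (hr : 0 < r) :
    (∀ z : ℝ, DifferentiableAt ℝ (ouF κ θ η r) z) ∧
    (∀ z : ℝ, DifferentiableAt ℝ (deriv (ouF κ θ η r)) z) ∧
    (∀ z : ℝ, η^2/2 * deriv (deriv (ouF κ θ η r)) z
        + κ * (θ - z) * deriv (ouF κ θ η r) z
        - r * ouF κ θ η r z = 0) := by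
  have hs : -1 < r/κ - 1 := by linarith [div_pos hr hκ]
  set c := Real.sqrt (2*κ/η^2) with hc
  let G : ℝ → ℝ → ℝ := fun s x =>
    ∫ υ in Set.Ioi (0:ℝ), υ ^ s * Real.exp (x * υ - υ^2/2)
  have hG : ∀ s, -1 < s → ∀ z,
      HasDerivAt (fun z => G s (c * (z - θ))) (c * G (s + 1) (c * (z - θ))) z := by
    intro s hs z
    have h := (hasDerivAt_integral_rpow_mul_exp_sub_sq hs (c * (z - θ))).comp z
      (((hasDerivAt_id z).sub_const θ).const_mul c)
    rw [mul_one, mul_comm] at h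
    exact h
  have h1 : ∀ z, HasDerivAt (ouF κ θ η r) (c * G (r/κ - 1 + 1) (c * (z - θ))) z := hG _ hs
  have hd : deriv (ouF κ θ η r) = fun z => c * G (r/κ - 1 + 1) (c * (z - θ)) :=
    funext fun z => (h1 z).deriv
  have h2 : ∀ z, HasDerivAt (deriv (ouF κ θ η r))
      (c * (c * G (r/κ - 1 + 1 + 1) (c * (z - θ)))) z := fun z => by
    rw [hd]
    exact (hG _ (by linarith) z).const_mul c
  refine ⟨fun z => (h1 z).differentiableAt, fun z => (h2 z).differentiableAt, fun z => ?_⟩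
  rw [(h2 z).deriv, (h1 z).deriv]
  have hrec : G (r/κ - 1 + 1 + 1) (c * (z - θ)) = c * (z - θ) * G (r/κ - 1 + 1) (c * (z - θ)) +
      (r/κ - 1 + 1) * ouF κ θ η r z := integral_rpow_add_two_mul_exp_sub_sq hs _
  have hc2 : η^2/2 * (c * c) = κ := by
    rw [hc, Real.mul_self_sqrt (by positivity)]
    field_simp
  have hrκ : κ * (r/κ - 1 + 1) = r := by
    field_simp
    ring
  linear_combination G (r/κ - 1 + 1 + 1) (c * (z - θ)) * hc2 + κ * hrec + ouF κ θ η r z * hrκ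
end

section
/- Let κ > 0, η > 0, r > 0 and θ ∈ ℝ, and define G(z) = ∫₀^∞ υ^{r/κ − 1} exp(√(2κ/η²)(θ − z)υ − υ²/2) dυ. Then G is twice differentiable on ℝ and satisfies (η²/2)G''(z) + κ(θ − z)G'(z) − r G(z) = 0 for every z ∈ ℝ. -/
/-- The decreasing solution G of the OU ODE. -/
noncomputable def ouG (κ θ η r : ℝ) (z : ℝ) : ℝ :=
  ∫ υ in Set.Ioi (0:ℝ),
    υ ^ (r/κ - 1) * Real.exp (Real.sqrt (2*κ/η^2) * (θ - z) * υ - υ^2/2)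

open MeasureTheory Set Filter Topology

/-- The Gaussian-damped moment integral `∫₀^∞ υ ^ s * exp (x υ - υ² / 2) dυ`. -/
noncomputable def gaussianMoment (s x : ℝ) : ℝ :=
  ∫ υ in Ioi (0 : ℝ), υ ^ s * Real.exp (x * υ - υ ^ 2 / 2)

theorem aestronglyMeasurable_gaussianMoment (s x : ℝ) :
    AEStronglyMeasurable (fun υ : ℝ => υ ^ s * Real.exp (x * υ - υ ^ 2 / 2))
      (volume.restrict (Ioi 0)) := by
  apply Measurable.aestronglyMeasurable
  fun_prop

theorem integrableOn_gaussianMoment {s : ℝ} (hs : -1 < s) (x : ℝ) :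
    IntegrableOn (fun υ : ℝ => υ ^ s * Real.exp (x * υ - υ ^ 2 / 2)) (Ioi 0) := by
  have h := (integrableOn_rpow_mul_exp_neg_mul_sq (b := 1 / 4) (by norm_num) hs).mul_const
    (Real.exp (x ^ 2))
  refine Integrable.mono' h (aestronglyMeasurable_gaussianMoment s x) ?_
  filter_upwards [ae_restrict_mem measurableSet_Ioi] with υ hυ
  have hυ : 0 < υ := hυ
  rw [Real.norm_of_nonneg (by positivity), mul_assoc, ← Real.exp_add]
  gcongr
  nlinarith [sq_nonneg (x - υ / 2)]

theorem hasDerivAt_gaussianMoment {s : ℝ} (hs : -1 < s) (x : ℝ) :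
    HasDerivAt (gaussianMoment s) (gaussianMoment (s + 1) x) x := by
  refine (hasDerivAt_integral_of_dominated_loc_of_deriv_le
    (F := fun y υ => υ ^ s * Real.exp (y * υ - υ ^ 2 / 2))
    (F' := fun y υ => υ ^ (s + 1) * Real.exp (y * υ - υ ^ 2 / 2))
    (bound := fun υ => υ ^ (s + 1) * Real.exp ((x + 1) * υ - υ ^ 2 / 2))
    (Iio_mem_nhds (lt_add_one x))
    (Eventually.of_forall fun y => aestronglyMeasurable_gaussianMoment s y)
    (integrableOn_gaussianMoment hs x) (aestronglyMeasurable_gaussianMoment (s + 1) x) ?_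
    (integrableOn_gaussianMoment (by linarith) (x + 1)) ?_).2
  · filter_upwards [ae_restrict_mem measurableSet_Ioi] with υ hυ y hy
    have hυ : 0 < υ := hυ
    have hy : y < x + 1 := hy
    rw [Real.norm_of_nonneg (by positivity)]
    gcongr
  · filter_upwards [ae_restrict_mem measurableSet_Ioi] with υ hυ y _
    have hυ : 0 < υ := hυ
    convert! ((((hasDerivAt_id y).mul_const υ).sub_const (υ ^ 2 / 2)).exp.const_mul (υ ^ s)) using 1
    rw [Real.rpow_add_one hυ.ne']
    simp only [id]
    ring

/-- Integration by parts: the total derivative of `υ ^ (s + 1) * exp (x υ - υ² / 2)` integrates to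
zero. -/
theorem gaussianMoment_recurrence {s : ℝ} (hs : -1 < s) (x : ℝ) :
    (s + 1) * gaussianMoment s x + x * gaussianMoment (s + 1) x - gaussianMoment (s + 2) x = 0 := by
  have i0 := (integrableOn_gaussianMoment hs x).const_mul (s + 1)
  have i1 := integrableOn_gaussianMoment (s := s + 1) (by linarith) x
  have i2 := integrableOn_gaussianMoment (s := s + 2) (by linarith) x
  have i01 : IntegrableOn (fun υ : ℝ => (s + 1) * (υ ^ s * Real.exp (x * υ - υ ^ 2 / 2))
      + x * (υ ^ (s + 1) * Real.exp (x * υ - υ ^ 2 / 2))) (Ioi 0) := i0.add (i1.const_mul x)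
  have hd : ∀ υ ∈ Ioi (0 : ℝ), HasDerivAt
      (fun υ : ℝ => υ ^ (s + 1) * Real.exp (x * υ - υ ^ 2 / 2))
      ((s + 1) * (υ ^ s * Real.exp (x * υ - υ ^ 2 / 2))
        + x * (υ ^ (s + 1) * Real.exp (x * υ - υ ^ 2 / 2))
        - υ ^ (s + 2) * Real.exp (x * υ - υ ^ 2 / 2)) υ := by
    intro υ hυ
    have hυ : 0 < υ := hυ
    convert! (Real.hasDerivAt_rpow_const (p := s + 1) (Or.inl hυ.ne')).mul
      ((((hasDerivAt_id υ).const_mul x).sub ((hasDerivAt_pow 2 υ).div_const 2)).exp) using 1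
    rw [show s + 2 = s + 1 + 1 by ring, Real.rpow_add_one hυ.ne' (s + 1), add_sub_cancel_right]
    simp
    ring
  have hcont : ContinuousWithinAt
      (fun υ : ℝ => υ ^ (s + 1) * Real.exp (x * υ - υ ^ 2 / 2)) (Ici 0) 0 := by
    refine ContinuousAt.continuousWithinAt (ContinuousAt.mul ?_ (by fun_prop))
    exact Real.continuousAt_rpow_const 0 (s + 1) (Or.inr (by linarith))
  have hint := integral_Ioi_of_hasDerivAt_of_tendsto hcont hd (i01.sub i2)
    (tendsto_zero_of_hasDerivAt_of_integrableOn_Ioi hd (i01.sub i2) i1)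
  rw [integral_sub i01 i2, integral_add i0 (i1.const_mul x), integral_const_mul,
    integral_const_mul, Real.zero_rpow (by linarith)] at hint
  simpa [gaussianMoment] using hint

/-- For κ, η, r > 0 and θ ∈ ℝ, G is twice differentiable on ℝ and satisfies
(η²/2)G'' + κ(θ − z)G' − rG = 0 everywhere. -/
theorem ouG_solves_ode (κ θ η r : ℝ) (hκ : 0 < κ) (hη : 0 < η) (hr : 0 < r) :
    (∀ z : ℝ, DifferentiableAt ℝ (ouG κ θ η r) z) ∧
    (∀ z : ℝ, DifferentiableAt ℝ (deriv (ouG κ θ η r)) z) ∧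
    (∀ z : ℝ, η^2/2 * deriv (deriv (ouG κ θ η r)) z
        + κ * (θ - z) * deriv (ouG κ θ η r) z
        - r * ouG κ θ η r z = 0) := by
  have hrκ : 0 < r / κ := div_pos hr hκ
  set c := Real.sqrt (2 * κ / η ^ 2) with hc
  have hc2 : c ^ 2 = 2 * κ / η ^ 2 := Real.sq_sqrt (by positivity)
  have hG : ouG κ θ η r = fun z => gaussianMoment (r / κ - 1) (c * (θ - z)) := rfl
  have hlin (z : ℝ) : HasDerivAt (fun z => c * (θ - z)) (-c) z := by
    simpa using ((hasDerivAt_id z).const_sub θ).const_mul c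
  have h1 (z : ℝ) : HasDerivAt (ouG κ θ η r) (gaussianMoment (r / κ) (c * (θ - z)) * -c) z := by
    have h := (hasDerivAt_gaussianMoment (s := r / κ - 1) (by linarith)
      (c * (θ - z))).comp z (hlin z)
    rwa [sub_add_cancel] at h
  have hderiv : deriv (ouG κ θ η r) = fun z => gaussianMoment (r / κ) (c * (θ - z)) * -c :=
    funext fun z => (h1 z).deriv
  have h2 (z : ℝ) : HasDerivAt (deriv (ouG κ θ η r))
      (gaussianMoment (r / κ + 1) (c * (θ - z)) * -c * -c) z := by
    rw [hderiv]
    exact ((hasDerivAt_gaussianMoment (by linarith) (c * (θ - z))).comp z (hlin z)).mul_const (-c)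
  refine ⟨fun z => (h1 z).differentiableAt, fun z => (h2 z).differentiableAt, fun z => ?_⟩
  have hrec := gaussianMoment_recurrence (s := r / κ - 1) (by linarith) (c * (θ - z))
  rw [sub_add_cancel, show r / κ - 1 + 2 = r / κ + 1 by ring] at hrec
  have hηc : η ^ 2 / 2 * c ^ 2 = κ := by rw [hc2]; field_simp
  have hκr : κ * (r / κ) = r := by field_simp
  rw [(h2 z).deriv, (h1 z).deriv, hG]
  linear_combination gaussianMoment (r / κ + 1) (c * (θ - z)) * hηc
    + gaussianMoment (r / κ - 1) (c * (θ - z)) * hκr - κ * hrec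
end

section
/- Let κ > 0, η > 0, r > 0, c > 0 and θ ∈ ℝ, and define h(z) = (η²/2)(1 − c e^z) + κ(θ − z) − r(e^{c e^z} − 1)/(c e^z) for z ∈ ℝ. Then there exists a unique ζ ∈ ℝ with h(ζ) = 0; moreover h(z) > 0 for z < ζ and h(z) < 0 for z > ζ. -/
/-- The difference quotient of `Real.exp` at `0` is monotone on the positive reals. -/
theorem exp_sub_one_div_le {u v : ℝ} (hu : 0 < u) (huv : u ≤ v) :
    (Real.exp u - 1) / u ≤ (Real.exp v - 1) / v := by
  simpa using convexOn_exp.secant_mono (Set.mem_univ 0) (Set.mem_univ u) (Set.mem_univ v)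
    hu.ne' (hu.trans_le huv).ne' huv


/-- For κ, η, r, c > 0 and θ ∈ ℝ, the function
h(z) = (η²/2)(1 − c e^z) + κ(θ − z) − r(e^{c e^z} − 1)/(c e^z)
has a unique root ζ; h > 0 below ζ and h < 0 above ζ. -/
theorem xou_exp_h_unique_root (κ θ η r c : ℝ)
    (hκ : 0 < κ) (hη : 0 < η) (hr : 0 < r) (hc : 0 < c)
    (h : ℝ → ℝ)
    (hh : h = fun z => η^2/2 * (1 - c * Real.exp z) + κ * (θ - z)
      - r * (Real.exp (c * Real.exp z) - 1) / (c * Real.exp z)) :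
    ∃ ζ : ℝ, h ζ = 0 ∧
      (∀ z : ℝ, h z = 0 → z = ζ) ∧
      (∀ z : ℝ, z < ζ → 0 < h z) ∧
      (∀ z : ℝ, ζ < z → h z < 0) := by
  have hu (z : ℝ) : 0 < c * Real.exp z := by positivity
  have hval (z : ℝ) : h z = η^2/2 * (1 - c * Real.exp z) + κ * (θ - z)
      - r * ((Real.exp (c * Real.exp z) - 1) / (c * Real.exp z)) := by
    rw [hh, ← mul_div_assoc]
  have hanti : StrictAnti h := by
    intro x y hxy
    have hexp : c * Real.exp x ≤ c * Real.exp y := by gcongr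
    have hquot := mul_le_mul_of_nonneg_left (exp_sub_one_div_le (hu x) hexp) hr.le
    have hquad : η^2/2 * (1 - c * Real.exp y) ≤ η^2/2 * (1 - c * Real.exp x) := by gcongr
    have hlin : κ * (θ - y) < κ * (θ - x) := by gcongr
    rw [hval x, hval y]
    linarith
  have hcont : Continuous h := by
    rw [hh]
    refine Continuous.sub (by fun_prop) (Continuous.div (by fun_prop) (by fun_prop) ?_)
    exact fun z => (hu z).ne'
  have hlog : c * Real.exp (-Real.log c) = 1 := by
    rw [Real.exp_neg, Real.exp_log hc, mul_inv_cancel₀ hc.ne']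
  have hpos : ∃ z, 0 ≤ h z := by
    let z := min (-Real.log c) (θ - r * (Real.exp 1 - 1) / κ)
    refine ⟨z, ?_⟩
    have hle : c * Real.exp z ≤ 1 := by
      rw [← hlog]
      gcongr
      exact min_le_left _ _
    have hquot := mul_le_mul_of_nonneg_left (exp_sub_one_div_le (hu z) hle) hr.le
    rw [div_one] at hquot
    have hquad : 0 ≤ η^2/2 * (1 - c * Real.exp z) := mul_nonneg (by positivity) (by linarith)
    have hlin : r * (Real.exp 1 - 1) ≤ κ * (θ - z) := by
      rw [← div_le_iff₀' hκ]
      linarith [min_le_right (-Real.log c) (θ - r * (Real.exp 1 - 1) / κ)]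
    rw [hval]
    linarith
  have hneg : ∃ z, h z ≤ 0 := by
    let z := max (-Real.log c) θ
    refine ⟨z, ?_⟩
    have hle : 1 ≤ c * Real.exp z := by
      rw [← hlog]
      gcongr
      exact le_max_left _ _
    have hquot : 0 ≤ r * ((Real.exp (c * Real.exp z) - 1) / (c * Real.exp z)) :=
      mul_nonneg hr.le (div_nonneg (by linarith [Real.one_le_exp (hu z).le]) (hu z).le)
    have hquad : η^2/2 * (1 - c * Real.exp z) ≤ 0 :=
      mul_nonpos_of_nonneg_of_nonpos (by positivity) (by linarith)
    have hlin : κ * (θ - z) ≤ 0 :=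
      mul_nonpos_of_nonneg_of_nonpos hκ.le (by linarith [le_max_right (-Real.log c) θ])
    rw [hval]
    linarith
  obtain ⟨ζ, hζ⟩ := mem_range_of_exists_le_of_exists_ge hcont hneg hpos
  exact ⟨ζ, hζ, fun z hz => hanti.injective (hz.trans hζ.symm),
    fun z hz => hζ ▸ hanti hz, fun z hz => hζ ▸ hanti hz⟩
end

section
/- Let κ > 0, η > 0, r > 0, c > 0 and θ ∈ ℝ, and let F(z) = ∫₀^∞ υ^{r/κ − 1} exp(√(2κ/η²)(z − θ)υ − υ²/2) dυ. Then there exists a unique b ∈ ℝ satisfying (1 − e^{−c e^{b}}) F'(b) = c e^{b} e^{−c e^{b}} F(b). Moreover, the function z ↦ (1 − e^{−c e^z})/F(z) is strictly increasing on (−∞, b] and strictly decreasing on [b, ∞); in particular (1 − e^{−c e^z})/F(z) ≤ (1 − e^{−c e^{b}})/F(b) for all z ∈ ℝ. -/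
open Real Set MeasureTheory Filter Topology

/-- The Mellin-type integral `∫₀^∞ υ^(s-1) exp(tυ - υ²/2) dυ`. -/
noncomputable def gaussMellin (s t : ℝ) : ℝ :=
  ∫ υ in Ioi (0 : ℝ), υ ^ (s - 1) * exp (t * υ - υ ^ 2 / 2)

theorem exp_mul_sub_sq_half_le (t υ : ℝ) :
    exp (t * υ - υ ^ 2 / 2) ≤ exp (t ^ 2) * exp (-(1 / 4) * υ ^ 2) := by
  rw [← exp_add, exp_le_exp]
  nlinarith [sq_nonneg (t - υ / 2)]

theorem integrableOn_gaussMellin {s : ℝ} (hs : 0 < s) (t : ℝ) :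
    IntegrableOn (fun υ : ℝ => υ ^ (s - 1) * exp (t * υ - υ ^ 2 / 2)) (Ioi 0) := by
  have h := (integrableOn_rpow_mul_exp_neg_mul_sq (b := 1 / 4) (by norm_num)
    (s := s - 1) (by linarith)).const_mul (exp (t ^ 2))
  refine h.mono' (by fun_prop) ?_
  filter_upwards [ae_restrict_mem measurableSet_Ioi] with υ hυ
  have hp : 0 ≤ υ ^ (s - 1) := rpow_nonneg (le_of_lt hυ) _
  rw [norm_of_nonneg (by positivity)]
  calc υ ^ (s - 1) * exp (t * υ - υ ^ 2 / 2)
      ≤ υ ^ (s - 1) * (exp (t ^ 2) * exp (-(1 / 4) * υ ^ 2)) := by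
        gcongr
        exact exp_mul_sub_sq_half_le t υ
    _ = _ := by ring

theorem gaussMellin_pos {s : ℝ} (hs : 0 < s) (t : ℝ) : 0 < gaussMellin s t := by
  have hpos : ∀ υ ∈ Ioi (0 : ℝ), 0 < υ ^ (s - 1) * exp (t * υ - υ ^ 2 / 2) :=
    fun υ hυ => mul_pos (rpow_pos_of_pos hυ _) (exp_pos _)
  rw [gaussMellin, setIntegral_pos_iff_support_of_nonneg_ae _ (integrableOn_gaussMellin hs t)]
  · have : Ioi (0 : ℝ) ⊆ Function.support
        (fun υ : ℝ => υ ^ (s - 1) * exp (t * υ - υ ^ 2 / 2)) ∩ Ioi 0 :=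
      fun υ hυ => ⟨(hpos υ hυ).ne', hυ⟩
    refine lt_of_lt_of_le ?_ (measure_mono this)
    simp
  · filter_upwards [ae_restrict_mem measurableSet_Ioi] with υ hυ using (hpos υ hυ).le

theorem hasDerivAt_gaussMellin {s : ℝ} (hs : 0 < s) (t : ℝ) :
    HasDerivAt (gaussMellin s) (gaussMellin (s + 1) t) t := by
  refine (hasDerivAt_integral_of_dominated_loc_of_deriv_le
    (F := fun t υ : ℝ => υ ^ (s - 1) * exp (t * υ - υ ^ 2 / 2))
    (F' := fun t υ : ℝ => υ ^ (s + 1 - 1) * exp (t * υ - υ ^ 2 / 2))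
    (bound := fun υ : ℝ => υ ^ (s + 1 - 1) * exp ((t + 1) * υ - υ ^ 2 / 2))
    (Metric.ball_mem_nhds t one_pos) (Eventually.of_forall fun _ => by fun_prop)
    (integrableOn_gaussMellin hs t) (by fun_prop) ?_
    (integrableOn_gaussMellin (by linarith) (t + 1)) ?_).2
  · filter_upwards [ae_restrict_mem measurableSet_Ioi] with υ hυ x hx
    have hυ' : 0 < υ := hυ
    have hx' : x ≤ t + 1 := by
      have := (abs_lt.1 (Real.dist_eq x t ▸ Metric.mem_ball.1 hx)).2
      linarith
    rw [norm_of_nonneg (by positivity)]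
    gcongr
  · filter_upwards [ae_restrict_mem measurableSet_Ioi] with υ hυ x _
    have hυ' : 0 < υ := hυ
    have h := ((((hasDerivAt_id x).mul_const υ).sub_const (υ ^ 2 / 2)).exp).const_mul
      (υ ^ (s - 1))
    refine h.congr_deriv ?_
    rw [show s + 1 - 1 = (s - 1) + 1 by ring, rpow_add_one hυ'.ne']
    simp only [id]
    ring

theorem integrableOn_gaussMellin_combination {s : ℝ} (hs : 0 < s) (t A B C : ℝ) :
    IntegrableOn (fun υ : ℝ => A * (υ ^ (s - 1) * exp (t * υ - υ ^ 2 / 2))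
      + B * (υ ^ (s + 1 - 1) * exp (t * υ - υ ^ 2 / 2))
      + C * (υ ^ (s + 2 - 1) * exp (t * υ - υ ^ 2 / 2))) (Ioi 0) :=
  (((integrableOn_gaussMellin hs t).const_mul A).add
    ((integrableOn_gaussMellin (s := s + 1) (by linarith) t).const_mul B)).add
    ((integrableOn_gaussMellin (s := s + 2) (by linarith) t).const_mul C)

theorem integral_gaussMellin_combination {s : ℝ} (hs : 0 < s) (t A B C : ℝ) :
    ∫ υ in Ioi (0 : ℝ), (A * (υ ^ (s - 1) * exp (t * υ - υ ^ 2 / 2))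
      + B * (υ ^ (s + 1 - 1) * exp (t * υ - υ ^ 2 / 2))
      + C * (υ ^ (s + 2 - 1) * exp (t * υ - υ ^ 2 / 2)))
      = A * gaussMellin s t + B * gaussMellin (s + 1) t + C * gaussMellin (s + 2) t := by
  have h0 := (integrableOn_gaussMellin hs t).const_mul A
  have h1 := (integrableOn_gaussMellin (s := s + 1) (by linarith) t).const_mul B
  have h2 := (integrableOn_gaussMellin (s := s + 2) (by linarith) t).const_mul C
  unfold gaussMellin
  rw [← integral_const_mul, ← integral_const_mul, ← integral_const_mul,
    ← integral_add h0 h1]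
  exact integral_add (h0.add h1) h2

theorem gaussMellin_sq_le {s : ℝ} (hs : 0 < s) (t : ℝ) :
    gaussMellin (s + 1) t ^ 2 ≤ gaussMellin s t * gaussMellin (s + 2) t := by
  have hquad : ∀ l : ℝ,
      0 ≤ l ^ 2 * gaussMellin s t - 2 * l * gaussMellin (s + 1) t + gaussMellin (s + 2) t := by
    intro l
    suffices 0 ≤ l ^ 2 * gaussMellin s t + -2 * l * gaussMellin (s + 1) t
        + 1 * gaussMellin (s + 2) t by linarith
    rw [← integral_gaussMellin_combination hs]
    refine setIntegral_nonneg measurableSet_Ioi fun υ hυ => ?_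
    have hυ' : 0 < υ := hυ
    rw [show s + 1 - 1 = (s - 1) + 1 by ring, show s + 2 - 1 = (s - 1) + 1 + 1 by ring,
      rpow_add_one hυ'.ne' (s - 1 + 1), rpow_add_one hυ'.ne' (s - 1)]
    have : 0 ≤ υ ^ (s - 1) * exp (t * υ - υ ^ 2 / 2) * (l - υ) ^ 2 := by positivity
    linarith
  have hp := gaussMellin_pos hs t
  have h := hquad (gaussMellin (s + 1) t / gaussMellin s t)
  field_simp at h
  linarith

theorem gaussMellin_add_two {s : ℝ} (hs : 0 < s) (t : ℝ) :
    gaussMellin (s + 2) t = t * gaussMellin (s + 1) t + s * gaussMellin s t := by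
  have hlim : Tendsto (fun υ : ℝ => υ ^ s * exp (t * υ - υ ^ 2 / 2)) atTop (𝓝 0) := by
    have hl := (tendsto_rpow_mul_exp_neg_mul_atTop_nhds_zero s 1 one_pos).const_mul
      (exp ((t + 1) ^ 2 / 2))
    rw [mul_zero] at hl
    refine squeeze_zero' ?_ ?_ hl
    · filter_upwards [eventually_ge_atTop 0] with υ hυ
      positivity
    · filter_upwards [eventually_ge_atTop 0] with υ hυ
      rw [mul_left_comm, ← exp_add]
      gcongr
      nlinarith [sq_nonneg (t + 1 - υ)]
  have hint := integral_Ioi_of_hasDerivAt_of_tendsto (a := 0) (m := 0)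
    (f := fun υ : ℝ => υ ^ s * exp (t * υ - υ ^ 2 / 2))
    ((continuousAt_rpow_const _ _ (Or.inr hs.le)).mul (by fun_prop)).continuousWithinAt
    (fun υ hυ => ?_) (integrableOn_gaussMellin_combination hs t s t (-1)) hlim
  · rw [integral_gaussMellin_combination hs] at hint
    simp only [zero_rpow hs.ne', zero_mul, sub_zero] at hint
    linarith
  · have hυ' : 0 < υ := hυ
    have h := (hasDerivAt_rpow_const (p := s) (Or.inl hυ'.ne')).mul
      ((((hasDerivAt_id υ).const_mul t).sub (((hasDerivAt_id υ).pow 2).div_const 2)).exp)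
    refine h.congr_deriv ?_
    rw [show s + 2 - 1 = s + 1 by ring, rpow_add_one hυ'.ne', add_sub_cancel_right]
    simp only [id, Pi.sub_apply, Pi.pow_apply]
    norm_num
    ring

theorem monotone_gaussMellin_ratio {s : ℝ} (hs : 0 < s) :
    Monotone fun t => gaussMellin (s + 1) t / gaussMellin s t := by
  have hd : ∀ t, HasDerivAt (fun t => gaussMellin (s + 1) t / gaussMellin s t) _ t := fun t =>
    (hasDerivAt_gaussMellin (s := s + 1) (by linarith) t).div (hasDerivAt_gaussMellin hs t)
      (gaussMellin_pos hs t).ne'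
  refine monotone_of_deriv_nonneg (fun t => (hd t).differentiableAt) fun t => ?_
  rw [(hd t).deriv]
  refine div_nonneg ?_ (sq_nonneg _)
  rw [show s + 1 + 1 = s + 2 by ring]
  linarith [gaussMellin_sq_le hs t]

/-- `x / (e^x - 1)`, written with decaying exponentials, is strictly decreasing for `x > 0`. -/
theorem strictAntiOn_mul_exp_neg_div :
    StrictAntiOn (fun x : ℝ => x * exp (-x) / (1 - exp (-x))) (Ioi 0) := by
  intro x hx y hy hxy
  have hx' : 0 < x := hx
  have hy' : 0 < y := hy
  have hform : ∀ z : ℝ, 0 < z →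
      z * exp (-z) / (1 - exp (-z)) = ((exp z - exp 0) / (z - 0))⁻¹ := by
    intro z hz
    have h1 : 0 < exp z - 1 := by linarith [add_one_lt_exp hz.ne']
    have h2 := exp_pos z
    rw [exp_neg, exp_zero, sub_zero, inv_div]
    have h3 : 1 - (exp z)⁻¹ = (exp z - 1) / exp z := by field_simp
    rw [h3]
    field_simp
  simp only [hform x hx', hform y hy']
  refine inv_strictAnti₀ ?_ (strictConvexOn_exp.secant_strict_mono (mem_univ 0) (mem_univ x)
    (mem_univ y) hx'.ne' hy'.ne' hxy)
  rw [exp_zero, sub_zero]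
  exact div_pos (by linarith [add_one_lt_exp hx'.ne']) hx'

/-- If the logarithmic derivative of `u` is strictly decreasing, that of `F` is nondecreasing and
the two cross, then `u / F` is unimodal and peaks at the unique crossing point. -/
theorem exists_unique_peak_div {u u' F F' : ℝ → ℝ} (hu : ∀ z, HasDerivAt u (u' z) z)
    (hF : ∀ z, HasDerivAt F (F' z) z) (hu0 : ∀ z, 0 < u z) (hF0 : ∀ z, 0 < F z)
    (hanti : StrictAnti fun z => u' z / u z) (hmono : Monotone fun z => F' z / F z)
    (hcont : Continuous fun z => u' z / u z - F' z / F z)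
    (hlow : ∃ z, F' z / F z ≤ u' z / u z) (hhigh : ∃ z, u' z / u z ≤ F' z / F z) :
    ∃ b, u b * F' b = u' b * F b ∧ (∀ b', u b' * F' b' = u' b' * F b' → b' = b) ∧
      StrictMonoOn (fun z => u z / F z) (Iic b) ∧ StrictAntiOn (fun z => u z / F z) (Ici b) ∧
      ∀ z, u z / F z ≤ u b / F b := by
  have hD : StrictAnti fun z => u' z / u z - F' z / F z := fun x y hxy =>
    by linarith [hanti hxy, hmono hxy.le]
  have hiff : ∀ z, u z * F' z = u' z * F z ↔ u' z / u z - F' z / F z = 0 := fun z => by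
    rw [sub_eq_zero, div_eq_div_iff (hu0 z).ne' (hF0 z).ne', eq_comm, mul_comm (u z)]
  obtain ⟨z₁, h₁⟩ := hlow
  obtain ⟨z₂, h₂⟩ := hhigh
  obtain ⟨b, hb⟩ := mem_range_of_exists_le_of_exists_ge hcont
    ⟨z₂, sub_nonpos.2 h₂⟩ ⟨z₁, sub_nonneg.2 h₁⟩
  have hb : u' b / u b - F' b / F b = 0 := hb
  have hd : ∀ z, HasDerivAt (fun z => u z / F z)
      (u z / F z * (u' z / u z - F' z / F z)) z := fun z => by
    have h1 := (hu0 z).ne'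
    have h2 := (hF0 z).ne'
    refine ((hu z).div (hF z) h2).congr_deriv ?_
    field_simp
  have hc : Continuous fun z => u z / F z :=
    continuous_iff_continuousAt.2 fun z => (hd z).continuousAt
  have hup : StrictMonoOn (fun z => u z / F z) (Iic b) := by
    refine strictMonoOn_of_deriv_pos (convex_Iic b) hc.continuousOn fun z hz => ?_
    rw [interior_Iic] at hz
    rw [(hd z).deriv]
    exact mul_pos (div_pos (hu0 z) (hF0 z)) (hb ▸ hD hz)
  have hdown : StrictAntiOn (fun z => u z / F z) (Ici b) := by
    refine strictAntiOn_of_deriv_neg (convex_Ici b) hc.continuousOn fun z hz => ?_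
    rw [interior_Ici] at hz
    rw [(hd z).deriv]
    exact mul_neg_of_pos_of_neg (div_pos (hu0 z) (hF0 z)) (hb ▸ hD hz)
  refine ⟨b, (hiff b).2 hb, fun b' hb' => hD.injective (((hiff b').1 hb').trans hb.symm),
    hup, hdown, fun z => ?_⟩
  rcases le_total z b with h | h
  · exact hup.monotoneOn h self_mem_Iic h
  · exact hdown.antitoneOn self_mem_Ici h h

theorem hasDerivAt_one_sub_exp_neg_mul_exp (c z : ℝ) :
    HasDerivAt (fun z => 1 - exp (-(c * exp z))) (c * exp z * exp (-(c * exp z))) z := by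
  refine (((hasDerivAt_exp z).const_mul c).neg.exp.const_sub 1).congr_deriv ?_
  simp only [Pi.neg_apply]
  ring

theorem ouF_eq_gaussMellin (κ θ η r z : ℝ) :
    ouF κ θ η r z = gaussMellin (r / κ) (√(2 * κ / η ^ 2) * (z - θ)) := rfl

/-- For κ, η, r, c > 0 and θ ∈ ℝ, there is a unique b solving the smooth-pasting
equation (1 − e^{−c e^b})F'(b) = c e^b e^{−c e^b} F(b), and
z ↦ (1 − e^{−c e^z})/F(z) is strictly increasing on (−∞, b], strictly decreasing
on [b, ∞), hence maximized at b. -/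
theorem xou_exp_threshold (κ θ η r c : ℝ)
    (hκ : 0 < κ) (hη : 0 < η) (hr : 0 < r) (hc : 0 < c) :
    ∃ b : ℝ,
      ((1 - Real.exp (-(c * Real.exp b))) * deriv (ouF κ θ η r) b
        = c * Real.exp b * Real.exp (-(c * Real.exp b)) * ouF κ θ η r b) ∧
      (∀ b' : ℝ,
        (1 - Real.exp (-(c * Real.exp b'))) * deriv (ouF κ θ η r) b'
          = c * Real.exp b' * Real.exp (-(c * Real.exp b')) * ouF κ θ η r b'
        → b' = b) ∧
      StrictMonoOn (fun z => (1 - Real.exp (-(c * Real.exp z))) / ouF κ θ η r z)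
        (Set.Iic b) ∧
      StrictAntiOn (fun z => (1 - Real.exp (-(c * Real.exp z))) / ouF κ θ η r z)
        (Set.Ici b) ∧
      (∀ z : ℝ, (1 - Real.exp (-(c * Real.exp z))) / ouF κ θ η r z
        ≤ (1 - Real.exp (-(c * Real.exp b))) / ouF κ θ η r b) := by
  set s := r / κ with hs_def
  have hs : 0 < s := div_pos hr hκ
  set a := √(2 * κ / η ^ 2) with ha_def
  have ha : 0 < a := sqrt_pos.2 (by positivity)
  have hF : ∀ z, HasDerivAt (ouF κ θ η r) (gaussMellin (s + 1) (a * (z - θ)) * a) z := fun z => by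
    have h : HasDerivAt (fun z : ℝ => a * (z - θ)) a z := by
      simpa using ((hasDerivAt_id z).sub_const θ).const_mul a
    exact (hasDerivAt_gaussMellin hs (a * (z - θ))).comp z h
  have hF0 : ∀ z, 0 < ouF κ θ η r z := fun z => gaussMellin_pos hs _
  have hx : ∀ z, 0 < c * exp z := fun z => mul_pos hc (exp_pos z)
  have hu0 : ∀ z, 0 < 1 - exp (-(c * exp z)) := fun z => by
    rw [sub_pos, exp_lt_one_iff, neg_lt_zero]
    exact hx z
  have hmono : Monotone fun z => gaussMellin (s + 1) (a * (z - θ)) * a / ouF κ θ η r z := by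
    intro x y hxy
    have h := mul_le_mul_of_nonneg_right (monotone_gaussMellin_ratio hs
      (show a * (x - θ) ≤ a * (y - θ) by gcongr)) ha.le
    simpa only [ouF_eq_gaussMellin, ← mul_div_right_comm] using h
  have hderiv : deriv (ouF κ θ η r) = fun z => gaussMellin (s + 1) (a * (z - θ)) * a :=
    funext fun z => (hF z).deriv
  rw [hderiv]
  refine exists_unique_peak_div (hasDerivAt_one_sub_exp_neg_mul_exp c) hF hu0 hF0
    (fun x y hxy => strictAntiOn_mul_exp_neg_div (hx x) (hx y) (by gcongr)) hmono ?_ ?_ ?_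
  · have h1 : Continuous (gaussMellin (s + 1)) := continuous_iff_continuousAt.2 fun t =>
      (hasDerivAt_gaussMellin (by linarith) t).continuousAt
    have h2 : Continuous (ouF κ θ η r) := continuous_iff_continuousAt.2 fun t =>
      (hF t).continuousAt
    exact (Continuous.div (by fun_prop) (by fun_prop) fun z => (hu0 z).ne').sub
      (Continuous.div (by fun_prop) h2 fun z => (hF0 z).ne')
  · refine ⟨min (-log c) (θ - 3 * s), ?_⟩
    set z := min (-log c) (θ - 3 * s)
    have hz1 : c * exp z ≤ 1 := by
      calc c * exp z ≤ c * exp (-log c) := by gcongr; exact min_le_left _ _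
        _ = 1 := by rw [exp_neg, exp_log hc, mul_inv_cancel₀ hc.ne']
    have hz2 : 3 * s ≤ θ - z := by linarith [min_le_right (-log c) (θ - 3 * s)]
    have hG : gaussMellin (s + 1) (a * (z - θ)) * a / ouF κ θ η r z ≤ 1 / 3 := by
      rw [div_le_iff₀ (hF0 z), ouF_eq_gaussMellin, ← hs_def, ← ha_def]
      have h1 := gaussMellin_add_two hs (a * (z - θ))
      have h2 := gaussMellin_pos (s := s + 2) (by linarith) (a * (z - θ))
      have h3 := mul_pos (gaussMellin_pos (s := s + 1) (by linarith) (a * (z - θ))) ha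
      refine le_of_mul_le_mul_left ?_ hs
      nlinarith [mul_le_mul_of_nonneg_right hz2 h3.le]
    refine hG.trans ?_
    rw [le_div_iff₀ (hu0 z)]
    have h1 : exp (-1) ≤ exp (-(c * exp z)) := exp_le_exp.2 (by linarith)
    have h2 : 1 / 3 ≤ exp (-1) := by
      rw [exp_neg, one_div]
      exact inv_anti₀ (exp_pos 1) (exp_one_lt_d9.le.trans (by norm_num))
    have h3 : 1 - exp (-(c * exp z)) ≤ c * exp z := by linarith [add_one_le_exp (-(c * exp z))]
    nlinarith [hx z]
  · set G := fun z => gaussMellin (s + 1) (a * (z - θ)) * a / ouF κ θ η r z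
    have hG0 : 0 < G 0 := div_pos (mul_pos (gaussMellin_pos (by linarith) _) ha) (hF0 0)
    refine ⟨2 / (c * G 0), ?_⟩
    set z := 2 / (c * G 0) with hz_def
    have hz : 0 < z := by positivity
    refine le_trans ?_ (hmono hz.le : G 0 ≤ G z)
    have hxz : 2 ≤ G 0 * (c * exp z) := by
      calc 2 = G 0 * (c * z) := by rw [hz_def]; field_simp
        _ ≤ G 0 * (c * exp z) := by gcongr; linarith [add_one_le_exp z]
    rw [div_le_iff₀ (hu0 z)]
    set x := c * exp z
    have hx0 : 0 < x := hx z
    have h1 := quadratic_le_exp_of_nonneg hx0.le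
    have h2 : 1 - exp (-x) = exp (-x) * (exp x - 1) := by
      rw [mul_sub, ← exp_add]; simp
    rw [h2]
    have h3 : x ≤ G 0 * (exp x - 1) := by
      have : G 0 * (x ^ 2 / 2) ≤ G 0 * (exp x - 1) := by gcongr; linarith
      nlinarith
    nlinarith [mul_le_mul_of_nonneg_left h3 (exp_pos (-x)).le]
end

section
/- Let κ > 0, η > 0, r > 0 and θ ∈ ℝ, and let F(z) = ∫₀^∞ υ^{r/κ − 1} exp(√(2κ/η²)(z − θ)υ − υ²/2) dυ. Then there exists a unique y ∈ ℝ satisfying F'(y) = F(y). Moreover, the function z ↦ e^{z}/F(z) is strictly increasing on (−∞, y] and strictly decreasing on [y, ∞); in particular e^{z}/F(z) ≤ e^{y}/F(y) for all z ∈ ℝ. -/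
open MeasureTheory Set Filter Topology

/-- The moment integral `∫₀^∞ v ^ (s - 1) exp (x v - v² / 2) dv`, a multiple of a parabolic
cylinder function. -/
noncomputable def gaussMoment (s x : ℝ) : ℝ :=
  ∫ v in Ioi (0 : ℝ), v ^ (s - 1) * Real.exp (x * v - v ^ 2 / 2)

theorem integrableOn_gaussMoment {s : ℝ} (hs : 0 < s) (x : ℝ) :
    IntegrableOn (fun v : ℝ => v ^ (s - 1) * Real.exp (x * v - v ^ 2 / 2)) (Ioi 0) := by
  have h := (integrableOn_rpow_mul_exp_neg_mul_sq (b := 1 / 4) (by norm_num)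
    (s := s - 1) (by linarith)).const_mul (Real.exp (x ^ 2))
  refine Integrable.mono' h (by fun_prop) ?_
  filter_upwards [ae_restrict_mem measurableSet_Ioi] with v hv
  have hv0 : 0 < v := hv
  have hp : 0 < v ^ (s - 1) := Real.rpow_pos_of_pos hv0 _
  rw [Real.norm_of_nonneg (by positivity), mul_left_comm, ← Real.exp_add]
  gcongr
  nlinarith [sq_nonneg (v / 2 - x)]

theorem gaussMoment_pos {s : ℝ} (hs : 0 < s) (x : ℝ) : 0 < gaussMoment s x := by
  have hpos : ∀ v ∈ Ioi (0 : ℝ), 0 < v ^ (s - 1) * Real.exp (x * v - v ^ 2 / 2) := fun v hv =>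
    mul_pos (Real.rpow_pos_of_pos hv _) (Real.exp_pos _)
  rw [gaussMoment, setIntegral_pos_iff_support_of_nonneg_ae _ (integrableOn_gaussMoment hs x)]
  · rw [inter_eq_right.mpr fun v hv => Function.mem_support.mpr (hpos v hv).ne']
    simp
  · filter_upwards [ae_restrict_mem measurableSet_Ioi] with v hv using (hpos v hv).le

theorem hasDerivAt_gaussMoment {s : ℝ} (hs : 0 < s) (x : ℝ) :
    HasDerivAt (gaussMoment s) (gaussMoment (s + 1) x) x := by
  refine (hasDerivAt_integral_of_dominated_loc_of_deriv_le
    (μ := volume.restrict (Ioi (0 : ℝ)))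
    (F := fun x v : ℝ => v ^ (s - 1) * Real.exp (x * v - v ^ 2 / 2))
    (F' := fun x v : ℝ => v ^ (s + 1 - 1) * Real.exp (x * v - v ^ 2 / 2))
    (bound := fun v : ℝ => v ^ (s + 1 - 1) * Real.exp ((x + 1) * v - v ^ 2 / 2))
    (Metric.ball_mem_nhds x one_pos)
    (Eventually.of_forall fun _ => by fun_prop)
    (integrableOn_gaussMoment hs x) (by fun_prop) ?_
    (integrableOn_gaussMoment (by linarith) (x + 1)) ?_).2
  · filter_upwards [ae_restrict_mem measurableSet_Ioi] with v hv y hy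
    have hv0 : 0 < v := hv
    have hp : 0 < v ^ (s + 1 - 1) := Real.rpow_pos_of_pos hv0 _
    rw [Real.norm_of_nonneg (by positivity)]
    rw [Metric.mem_ball, Real.dist_eq, abs_lt] at hy
    gcongr
    linarith
  · filter_upwards [ae_restrict_mem measurableSet_Ioi] with v hv y _
    have hv0 : v ≠ 0 := (mem_Ioi.mp hv).ne'
    have h := ((((hasDerivAt_id y).mul_const v).sub_const (v ^ 2 / 2)).exp).const_mul
      (v ^ (s - 1))
    refine h.congr_deriv ?_
    rw [show s + 1 - 1 = s - 1 + 1 by ring, Real.rpow_add_one hv0]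
    simp only [id]
    ring

/-- Integration by parts. -/
theorem gaussMoment_add_two {s : ℝ} (hs : 0 < s) (x : ℝ) :
    gaussMoment (s + 2) x = x * gaussMoment (s + 1) x + s * gaussMoment s x := by
  have i0 := integrableOn_gaussMoment hs x
  have i1 := integrableOn_gaussMoment (s := s + 1) (by linarith) x
  have i2 := integrableOn_gaussMoment (s := s + 2) (by linarith) x
  have hd : ∀ v ∈ Ioi (0 : ℝ),
      HasDerivAt (fun v : ℝ => v ^ (s + 1 - 1) * Real.exp (x * v - v ^ 2 / 2))
        (s * (v ^ (s - 1) * Real.exp (x * v - v ^ 2 / 2))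
          + x * (v ^ (s + 1 - 1) * Real.exp (x * v - v ^ 2 / 2))
          - v ^ (s + 2 - 1) * Real.exp (x * v - v ^ 2 / 2)) v := by
    intro v hv
    have hv0 : v ≠ 0 := (mem_Ioi.mp hv).ne'
    have h1 := Real.hasDerivAt_rpow_const (x := v) (p := s + 1 - 1) (Or.inl hv0)
    have h2 := (((hasDerivAt_id v).const_mul x).sub (((hasDerivAt_id v).pow 2).div_const 2)).exp
    refine (h1.mul h2).congr_deriv ?_
    rw [show s + 2 - 1 = s + 1 - 1 + 1 by ring, Real.rpow_add_one hv0]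
    simp only [id, add_sub_cancel_right, Pi.sub_apply, Pi.pow_apply]
    push_cast
    ring
  have hi := ((i0.const_mul s).add (i1.const_mul x)).sub i2
  have hc : ContinuousWithinAt (fun v : ℝ => v ^ (s + 1 - 1) * Real.exp (x * v - v ^ 2 / 2))
      (Ici 0) 0 := by
    refine ContinuousAt.continuousWithinAt (ContinuousAt.mul ?_ (by fun_prop))
    exact Real.continuousAt_rpow_const _ _ (Or.inr (by linarith))
  have ht := tendsto_zero_of_hasDerivAt_of_integrableOn_Ioi hd hi i1
  have h := integral_Ioi_of_hasDerivAt_of_tendsto hc hd hi ht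
  rw [integral_sub (by exact (i0.const_mul s).add (i1.const_mul x)) i2,
    integral_add (i0.const_mul s) (i1.const_mul x), integral_const_mul, integral_const_mul] at h
  simp only [add_sub_cancel_right, Real.zero_rpow hs.ne', zero_mul, sub_zero] at h
  simp only [gaussMoment, add_sub_cancel_right]
  linarith

/-- The strict Cauchy–Schwarz inequality for consecutive moments. -/
theorem gaussMoment_sq_lt {s : ℝ} (hs : 0 < s) (x : ℝ) :
    gaussMoment (s + 1) x ^ 2 < gaussMoment s x * gaussMoment (s + 2) x := by
  have i0 := integrableOn_gaussMoment hs x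
  have i1 := integrableOn_gaussMoment (s := s + 1) (by linarith) x
  have i2 := integrableOn_gaussMoment (s := s + 2) (by linarith) x
  have p0 := gaussMoment_pos hs x
  have p1 := gaussMoment_pos (s := s + 1) (by linarith) x
  set m := gaussMoment (s + 1) x / gaussMoment s x with hm
  let f : ℝ → ℝ := fun v => v ^ (s + 2 - 1) * Real.exp (x * v - v ^ 2 / 2)
    - 2 * m * (v ^ (s + 1 - 1) * Real.exp (x * v - v ^ 2 / 2))
    + m ^ 2 * (v ^ (s - 1) * Real.exp (x * v - v ^ 2 / 2))
  have hf : ∀ v ∈ Ioi (0 : ℝ),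
      f v = v ^ (s - 1) * Real.exp (x * v - v ^ 2 / 2) * (v - m) ^ 2 := by
    intro v hv
    have hv0 : v ≠ 0 := (mem_Ioi.mp hv).ne'
    simp only [f]
    rw [show s + 2 - 1 = s - 1 + 1 + 1 by ring, show s + 1 - 1 = s - 1 + 1 by ring,
      Real.rpow_add_one hv0, Real.rpow_add_one hv0]
    ring
  have hint : IntegrableOn f (Ioi 0) := (i2.sub (i1.const_mul (2 * m))).add (i0.const_mul (m ^ 2))
  have hpos : 0 < ∫ v in Ioi (0 : ℝ), f v := by
    rw [setIntegral_pos_iff_support_of_nonneg_ae _ hint]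
    · refine lt_of_lt_of_le ?_ (measure_mono (s := Ioi m) fun v hv => ?_)
      · simp
      · have hv0 : 0 < v := (div_pos p1 p0).trans hv
        refine ⟨?_, hv0⟩
        rw [Function.mem_support, hf v hv0]
        have h1 : 0 < v - m := sub_pos.mpr hv
        have h2 := Real.rpow_pos_of_pos hv0 (s - 1)
        positivity
    · filter_upwards [ae_restrict_mem measurableSet_Ioi] with v hv
      rw [hf v hv]
      have h2 := Real.rpow_pos_of_pos hv (s - 1)
      simp only [Pi.zero_apply]
      positivity
  have he : ∫ v in Ioi (0 : ℝ), f v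
      = gaussMoment (s + 2) x - 2 * m * gaussMoment (s + 1) x + m ^ 2 * gaussMoment s x := by
    simp only [f, gaussMoment]
    rw [integral_add (by exact i2.sub (i1.const_mul (2 * m))) (i0.const_mul (m ^ 2)),
      integral_sub i2 (i1.const_mul (2 * m)), integral_const_mul, integral_const_mul]
  have hm' : gaussMoment (s + 1) x = m * gaussMoment s x := by
    rw [hm]
    field_simp
  rw [he, hm'] at hpos
  rw [hm']
  nlinarith [mul_pos p0 hpos]

/-- The logarithmic derivative of `gaussMoment s`. -/
noncomputable def gaussMomentRatio (s x : ℝ) : ℝ := gaussMoment (s + 1) x / gaussMoment s x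

theorem gaussMomentRatio_pos {s : ℝ} (hs : 0 < s) (x : ℝ) : 0 < gaussMomentRatio s x :=
  div_pos (gaussMoment_pos (by linarith) x) (gaussMoment_pos hs x)

/-- The Riccati equation for the logarithmic derivative. -/
theorem hasDerivAt_gaussMomentRatio {s : ℝ} (hs : 0 < s) (x : ℝ) :
    HasDerivAt (gaussMomentRatio s)
      (x * gaussMomentRatio s x + s - gaussMomentRatio s x ^ 2) x := by
  have p0 := gaussMoment_pos hs x
  refine ((hasDerivAt_gaussMoment (s := s + 1) (by linarith) x).div
    (hasDerivAt_gaussMoment hs x) p0.ne').congr_deriv ?_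
  rw [add_assoc, one_add_one_eq_two, gaussMoment_add_two hs, gaussMomentRatio]
  field_simp

theorem gaussMomentRatio_sq_lt {s : ℝ} (hs : 0 < s) (x : ℝ) :
    gaussMomentRatio s x ^ 2 < x * gaussMomentRatio s x + s := by
  have p0 := gaussMoment_pos hs x
  have h := gaussMoment_sq_lt hs x
  rw [gaussMoment_add_two hs] at h
  have e : gaussMoment (s + 1) x = gaussMomentRatio s x * gaussMoment s x := by
    rw [gaussMomentRatio]
    field_simp
  rw [e] at h
  have p2 : 0 < gaussMoment s x ^ 2 := by positivity
  nlinarith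

theorem strictMono_gaussMomentRatio {s : ℝ} (hs : 0 < s) : StrictMono (gaussMomentRatio s) := by
  refine strictMono_of_deriv_pos fun x => ?_
  rw [(hasDerivAt_gaussMomentRatio hs x).deriv]
  linarith [gaussMomentRatio_sq_lt hs x]

theorem exists_gaussMomentRatio_lt {s M : ℝ} (hs : 0 < s) (hM : 0 < M) :
    ∃ x, gaussMomentRatio s x < M := by
  refine ⟨-(s / M), ?_⟩
  have h1 := gaussMomentRatio_sq_lt hs (-(s / M))
  have h2 := gaussMomentRatio_pos hs (-(s / M))
  by_contra! h
  have h3 : s / M * M = s := by field_simp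
  nlinarith [mul_le_mul_of_nonneg_left h (div_pos hs hM).le]

theorem exists_lt_gaussMomentRatio {s : ℝ} (hs : 0 < s) (M : ℝ) :
    ∃ x, M < gaussMomentRatio s x := by
  by_contra! h
  have p := gaussMomentRatio_pos hs 0
  set m₀ := gaussMomentRatio s 0
  set X := (M ^ 2 + 1) / m₀
  have hX : X * m₀ = M ^ 2 + 1 := div_mul_cancel₀ _ p.ne'
  have hX0 : 0 ≤ X := by positivity
  have hdiff : Differentiable ℝ (gaussMomentRatio s) := fun x =>
    (hasDerivAt_gaussMomentRatio hs x).differentiableAt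
  have hge : ∀ x ∈ interior (Ici X), 1 ≤ deriv (gaussMomentRatio s) x := by
    intro x hx
    have hx : X ≤ x := interior_subset hx
    rw [(hasDerivAt_gaussMomentRatio hs x).deriv]
    have h1 : m₀ ≤ gaussMomentRatio s x :=
      (strictMono_gaussMomentRatio hs).monotone (hX0.trans hx)
    have h2 : X * m₀ ≤ x * gaussMomentRatio s x := by gcongr; exact hX0.trans hx
    have h3 : gaussMomentRatio s x ^ 2 ≤ M ^ 2 := by
      have := h x
      have := gaussMomentRatio_pos hs x
      gcongr
    linarith
  have hM : 0 < M := p.trans_le (h 0)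
  have key := (convex_Ici X).mul_sub_le_image_sub_of_le_deriv hdiff.continuous.continuousOn
    hdiff.differentiableOn hge X self_mem_Ici (X + M) (by simp [hM.le]) (by linarith)
  linarith [h (X + M), gaussMomentRatio_pos hs X]

theorem exists_gaussMomentRatio_eq {s M : ℝ} (hs : 0 < s) (hM : 0 < M) :
    ∃ x, gaussMomentRatio s x = M := by
  have hc : Continuous (gaussMomentRatio s) :=
    continuous_iff_continuousAt.mpr fun x => (hasDerivAt_gaussMomentRatio hs x).continuousAt
  obtain ⟨x₁, h₁⟩ := exists_gaussMomentRatio_lt hs hM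
  obtain ⟨x₂, h₂⟩ := exists_lt_gaussMomentRatio hs M
  exact mem_range_of_exists_le_of_exists_ge hc ⟨x₁, h₁.le⟩ ⟨x₂, h₂.le⟩

/-- For κ, η, r > 0 and θ ∈ ℝ, there is a unique y with F'(y) = F(y), and
z ↦ e^z/F(z) is strictly increasing on (−∞, y], strictly decreasing on [y, ∞),
hence maximized at y. -/
theorem xou_power_threshold (κ θ η r : ℝ)
    (hκ : 0 < κ) (hη : 0 < η) (hr : 0 < r) :
    ∃ y : ℝ,
      deriv (ouF κ θ η r) y = ouF κ θ η r y ∧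
      (∀ y' : ℝ, deriv (ouF κ θ η r) y' = ouF κ θ η r y' → y' = y) ∧
      StrictMonoOn (fun z => Real.exp z / ouF κ θ η r z) (Set.Iic y) ∧
      StrictAntiOn (fun z => Real.exp z / ouF κ θ η r z) (Set.Ici y) ∧
      (∀ z : ℝ, Real.exp z / ouF κ θ η r z ≤ Real.exp y / ouF κ θ η r y) := by
  have hs : 0 < r / κ := div_pos hr hκ
  have hc : 0 < Real.sqrt (2 * κ / η ^ 2) := by positivity
  set F := ouF κ θ η r
  set s := r / κ
  set c := Real.sqrt (2 * κ / η ^ 2)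
  have hFG : ∀ z, F z = gaussMoment s (c * (z - θ)) := fun z => rfl
  have hpos : ∀ z, 0 < F z := fun z => gaussMoment_pos hs _
  let m : ℝ → ℝ := fun z => c * gaussMomentRatio s (c * (z - θ))
  have hm : StrictMono m := fun a b hab =>
    mul_lt_mul_of_pos_left (strictMono_gaussMomentRatio hs
      (mul_lt_mul_of_pos_left (sub_lt_sub_right hab θ) hc)) hc
  have hderiv : ∀ z, HasDerivAt F (m z * F z) z := by
    intro z
    have h := (hasDerivAt_gaussMoment hs (c * (z - θ))).comp z
      (((hasDerivAt_id z).sub_const θ).const_mul c)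
    refine h.congr_deriv ?_
    have := (hpos z).ne'
    rw [hFG] at this ⊢
    simp only [m, gaussMomentRatio]
    field_simp
  obtain ⟨x, hx⟩ := exists_gaussMomentRatio_eq hs (inv_pos.mpr hc)
  have hy : m (x / c + θ) = 1 := by
    have : c * (x / c + θ - θ) = x := by field_simp; ring
    simp only [m, this, hx]
    exact mul_inv_cancel₀ hc.ne'
  set y := x / c + θ
  have hquot : ∀ z, HasDerivAt (fun z => Real.exp z / F z)
      (Real.exp z / F z * (1 - m z)) z := by
    intro z
    refine ((Real.hasDerivAt_exp z).div (hderiv z) (hpos z).ne').congr_deriv ?_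
    have := (hpos z).ne'
    field_simp
  have hcont : Continuous fun z => Real.exp z / F z :=
    continuous_iff_continuousAt.mpr fun z => (hquot z).continuousAt
  have hinc : StrictMonoOn (fun z => Real.exp z / F z) (Iic y) := by
    refine strictMonoOn_of_deriv_pos (convex_Iic y) hcont.continuousOn fun z hz => ?_
    rw [interior_Iic] at hz
    rw [(hquot z).deriv]
    exact mul_pos (div_pos (Real.exp_pos z) (hpos z)) (by linarith [hm hz])
  have hdec : StrictAntiOn (fun z => Real.exp z / F z) (Ici y) := by
    refine strictAntiOn_of_deriv_neg (convex_Ici y) hcont.continuousOn fun z hz => ?_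
    rw [interior_Ici] at hz
    rw [(hquot z).deriv]
    exact mul_neg_of_pos_of_neg (div_pos (Real.exp_pos z) (hpos z)) (by linarith [hm hz])
  refine ⟨y, ?_, fun y' h => hm.injective ?_, hinc, hdec, fun z => ?_⟩
  · rw [(hderiv y).deriv, hy, one_mul]
  · rw [(hderiv y').deriv] at h
    rw [hy]
    exact mul_right_cancel₀ (hpos y').ne' (by rw [h, one_mul])
  · rcases le_total z y with h | h
    · exact hinc.monotoneOn h self_mem_Iic h
    · exact hdec.antitoneOn self_mem_Ici h h
end
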